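/- arXiv:1507.07485 — 2 statements merged into one kernel-verified Lean document; each statement's English description precedes it below -/
import Mathlib

section
/- Let a = (a_1, a_2, ...) be a sequence of nonzero complex numbers with a_2 ≠ −a_1^2 and (a_2, a_3) ≠ (a_1^2, a_1^3). Then Λ_a is Cohen–Macaulay (equivalently, Λ_a is a free module over C[Q_1,Q_2]) if and only if for every i ≥ 1 the degree-i homogeneous component Λ_a[i] has codimension exactly 1 in the space of degree-i homogeneous polynomials in C[y,z], i.e. dim_C Λ_a[i] = i. -/
open MvPolynomial

set_option synthInstance.maxHeartbeats 1000000
set_option maxHeartbeats 1000000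

noncomputable section

/-- The polynomial ring `ℂ[y,z]`, with `y = X 0`, `z = X 1`. -/
abbrev R2 := MvPolynomial (Fin 2) ℂ

/-- The generalized power sum `Q_i = a_i y^i + z^i`. -/
def Q2 (a : ℕ → ℂ) (i : ℕ) : R2 := C (a i) * X 0 ^ i + X 1 ^ i

/-- The algebra `Λ_a` generated by the `Q_i`, `i ≥ 1`. -/
def Lam (a : ℕ → ℂ) : Subalgebra ℂ R2 :=
  Algebra.adjoin ℂ {f : R2 | ∃ i : ℕ, 1 ≤ i ∧ f = Q2 a i}

/-- The subalgebra `ℂ[Q_1, Q_2]`. -/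
def Bsub (a : ℕ → ℂ) : Subalgebra ℂ R2 :=
  Algebra.adjoin ℂ {Q2 a 1, Q2 a 2}

/-- `Λ_a`, viewed as a module over `ℂ[Q_1,Q_2]` (as the `ℂ[Q_1,Q_2]`-span of `Λ_a` in
`ℂ[y,z]`, which coincides with `Λ_a` since `Q_1, Q_2 ∈ Λ_a`). -/
def LamMod (a : ℕ → ℂ) : Submodule ↥(Bsub a) R2 :=
  Submodule.span (Bsub a) (Lam a : Set R2)

/-- The degree-`n` homogeneous component of a graded subspace of `ℂ[y,z]`. -/
def comp2 (M : Submodule ℂ R2) (n : ℕ) : Submodule ℂ R2 :=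
  M ⊓ homogeneousSubmodule (Fin 2) ℂ n

theorem finrank_homogeneousSubmodule_fin_two (n : ℕ) :
    Module.finrank ℂ (homogeneousSubmodule (Fin 2) ℂ n) = n + 1 := by
  have e : {d : Fin 2 →₀ ℕ | d.degree = n} ≃
      (Finset.HasAntidiagonal.antidiagonal n : Finset (ℕ × ℕ)) :=
    { toFun := fun d => ⟨(d.1 0, d.1 1), by
        have := d.2
        simpa [Finsupp.degree_eq_sum, Fin.sum_univ_two] using this⟩
      invFun := fun p => ⟨Finsupp.equivFunOnFinite.symm ![p.1.1, p.1.2], by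
        have := Finset.HasAntidiagonal.mem_antidiagonal.1 p.2
        simpa [Finsupp.degree_eq_sum, Fin.sum_univ_two] using this⟩
      left_inv := fun d => by
        ext i
        fin_cases i <;> simp
      right_inv := fun p => by simp }
  have : Finite {d : Fin 2 →₀ ℕ | d.degree = n} := Finite.of_equiv _ e.symm
  have : Fintype {d : Fin 2 →₀ ℕ | d.degree = n} := Fintype.ofFinite _
  rw [homogeneousSubmodule_eq_finsupp_supported,
    (AddMonoidAlgebra.supportedEquivFinsupp {d : Fin 2 →₀ ℕ | d.degree = n}).finrank_eq,
    Module.finrank_finsupp_self, Fintype.card_congr e]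
  simp

instance finiteDimensional_homogeneousSubmodule_fin_two (n : ℕ) :
    FiniteDimensional ℂ (homogeneousSubmodule (Fin 2) ℂ n) :=
  FiniteDimensional.of_finrank_pos (by rw [finrank_homogeneousSubmodule_fin_two]; omega)

theorem homogeneousComponent_mul_of_isHomogeneous {σ R : Type*} [CommSemiring R]
    {p : MvPolynomial σ R} {k : ℕ} (hp : p.IsHomogeneous k) (c : MvPolynomial σ R) (n : ℕ) :
    homogeneousComponent n (c * p) =
      if k ≤ n then homogeneousComponent (n - k) c * p else 0 := by
  have h : ∀ i, homogeneousComponent n (homogeneousComponent i c * p) =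
      if n = i + k then homogeneousComponent i c * p else 0 := fun i =>
    homogeneousComponent_of_mem ((homogeneousComponent_isHomogeneous i c).mul hp)
  conv_lhs => rw [← sum_homogeneousComponent c, Finset.sum_mul, map_sum]
  simp only [h]
  split_ifs with hkn
  · have hiff : ∀ i, n = i + k ↔ n - k = i := fun i => by omega
    simp only [hiff, Finset.sum_ite_eq]
    split_ifs with hn
    · rfl
    · rw [homogeneousComponent_eq_zero _ _ (by rw [Finset.mem_range] at hn; omega), zero_mul]
  · exact Finset.sum_eq_zero fun i _ => if_neg (by omega)

theorem isHomogeneous_Q2 (a : ℕ → ℂ) (i : ℕ) : (Q2 a i).IsHomogeneous i :=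
  (isHomogeneous_C_mul_X_pow _ _ _).add (isHomogeneous_X_pow _ _)

theorem Q2_mem_Lam (a : ℕ → ℂ) {i : ℕ} (hi : 1 ≤ i) : Q2 a i ∈ Lam a :=
  Algebra.subset_adjoin ⟨i, hi, rfl⟩

theorem Q2_one_mem_Bsub (a : ℕ → ℂ) : Q2 a 1 ∈ Bsub a := Algebra.subset_adjoin (by simp)

theorem Q2_two_mem_Bsub (a : ℕ → ℂ) : Q2 a 2 ∈ Bsub a := Algebra.subset_adjoin (by simp)

theorem Bsub_le_Lam (a : ℕ → ℂ) : Bsub a ≤ Lam a := by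
  refine Algebra.adjoin_le ?_
  rintro f (rfl | rfl)
  · exact Q2_mem_Lam a le_rfl
  · exact Q2_mem_Lam a one_le_two

theorem mem_LamMod {a : ℕ → ℂ} {r : R2} : r ∈ LamMod a ↔ r ∈ Lam a := by
  refine ⟨fun h => ?_, fun h => Submodule.subset_span h⟩
  induction h using Submodule.span_induction with
  | mem x hx => exact hx
  | zero => exact zero_mem _
  | add x y _ _ hx hy => exact add_mem hx hy
  | smul b x _ hx => exact mul_mem (Bsub_le_Lam a b.2) hx

theorem homogeneousComponent_mem_of_mem_span {σ R : Type*} [CommSemiring R]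
    {s : Set (MvPolynomial σ R)} (N : ℕ → Submodule R (MvPolynomial σ R))
    (hs : ∀ f ∈ s, ∃ k, f.IsHomogeneous k ∧ f ∈ N k)
    {r : MvPolynomial σ R} (hr : r ∈ Submodule.span R s) (n : ℕ) :
    homogeneousComponent n r ∈ N n := by
  induction hr using Submodule.span_induction with
  | mem x hx =>
    obtain ⟨k, hk, hkN⟩ := hs x hx
    rw [homogeneousComponent_of_mem hk]
    split_ifs with h
    · exact h ▸ hkN
    · exact zero_mem _
  | zero => simp
  | add x y _ _ hx hy => rw [map_add]; exact add_mem hx hy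
  | smul c x _ hx => rw [map_smul]; exact Submodule.smul_mem _ _ hx

/-- An algebra generated by homogeneous elements is graded. -/
theorem homogeneousComponent_mem_of_mem_adjoin {σ R : Type*} [CommSemiring R]
    {s : Set (MvPolynomial σ R)} (hs : ∀ f ∈ s, ∃ k, f.IsHomogeneous k)
    {r : MvPolynomial σ R} (hr : r ∈ Algebra.adjoin R s) (n : ℕ) :
    homogeneousComponent n r ∈ Algebra.adjoin R s := by
  rw [← Subalgebra.mem_toSubmodule, Algebra.adjoin_eq_span] at hr ⊢
  refine homogeneousComponent_mem_of_mem_span (fun _ => _) (fun m hm => ?_) hr n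
  suffices ∃ k, m.IsHomogeneous k from this.imp fun k hk => ⟨hk, Submodule.subset_span hm⟩
  induction hm using Submonoid.closure_induction with
  | mem x hx => exact hs x hx
  | one => exact ⟨0, isHomogeneous_one _ _⟩
  | mul x y _ _ hx hy =>
    obtain ⟨k, hk⟩ := hx
    obtain ⟨l, hl⟩ := hy
    exact ⟨k + l, hk.mul hl⟩

theorem homogeneousComponent_mem_Bsub {a : ℕ → ℂ} {r : R2} (hr : r ∈ Bsub a) (n : ℕ) :
    homogeneousComponent n r ∈ Bsub a := by
  refine homogeneousComponent_mem_of_mem_adjoin ?_ hr n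
  rintro f (rfl | rfl)
  · exact ⟨1, isHomogeneous_Q2 a 1⟩
  · exact ⟨2, isHomogeneous_Q2 a 2⟩

theorem homogeneousComponent_mem_Lam {a : ℕ → ℂ} {r : R2} (hr : r ∈ Lam a) (n : ℕ) :
    homogeneousComponent n r ∈ Lam a := by
  refine homogeneousComponent_mem_of_mem_adjoin ?_ hr n
  rintro f ⟨i, -, rfl⟩
  exact ⟨i, isHomogeneous_Q2 a i⟩

/-- In degrees at most `2` the algebras `Λ_a` and `ℂ[Q_1,Q_2]` agree. -/
theorem homogeneousComponent_mem_Bsub_of_mem_Lam {a : ℕ → ℂ} {r : R2} (hr : r ∈ Lam a) {n : ℕ}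
    (hn : n ≤ 2) : homogeneousComponent n r ∈ Bsub a := by
  rw [Lam, ← Subalgebra.mem_toSubmodule, Algebra.adjoin_eq_span] at hr
  have key := homogeneousComponent_mem_of_mem_span
    (fun k => if k ≤ 2 then Subalgebra.toSubmodule (Bsub a) else ⊤) (fun m hm => ?_) hr n
  · simpa only [if_pos hn, Subalgebra.mem_toSubmodule] using key
  suffices ∃ k, m.IsHomogeneous k ∧ (k ≤ 2 → m ∈ Bsub a) by
    refine this.imp fun k hk => ⟨hk.1, ?_⟩
    split_ifs with h
    · exact hk.2 h
    · trivial
  induction hm using Submonoid.closure_induction with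
  | mem x hx =>
    obtain ⟨i, hi, rfl⟩ := hx
    refine ⟨i, isHomogeneous_Q2 a i, fun h => ?_⟩
    interval_cases i
    · exact Q2_one_mem_Bsub a
    · exact Q2_two_mem_Bsub a
  | one => exact ⟨0, isHomogeneous_one _ _, fun _ => one_mem _⟩
  | mul x y _ _ hx hy =>
    obtain ⟨k, hk, hk'⟩ := hx
    obtain ⟨l, hl, hl'⟩ := hy
    exact ⟨k + l, hk.mul hl, fun h => mul_mem (hk' (by omega)) (hl' (by omega))⟩

theorem exists_eq_add_mul_X (a : ℕ → ℂ) (h2 : a 2 ≠ -(a 1) ^ 2) (r : R2) :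
    ∃ b ∈ Bsub a, ∃ c ∈ Bsub a, r = b + c * X 0 := by
  have hs : a 2 + a 1 ^ 2 ≠ 0 := fun h => h2 (eq_neg_of_add_eq_zero_left h)
  have hC : ∀ t : ℂ, (C t : R2) ∈ Bsub a := fun t => (Bsub a).algebraMap_mem t
  have h1 := Q2_one_mem_Bsub a
  have hsq : (X 0 : R2) ^ 2 = C (a 2 + a 1 ^ 2)⁻¹ * (Q2 a 2 - Q2 a 1 ^ 2) +
      C (a 2 + a 1 ^ 2)⁻¹ * (C (2 * a 1) * Q2 a 1) * X 0 := by
    have hC1 : (C (a 2 + a 1 ^ 2)⁻¹ : R2) * (C (a 2) + C (a 1) ^ 2) = 1 := by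
      rw [← C_pow, ← C_add, ← C_mul, inv_mul_cancel₀ hs, C_1]
    have hC2 : (C (2 * a 1) : R2) = 2 * C (a 1) := by rw [C_mul]; rfl
    simp only [Q2, hC2]
    linear_combination (-(X 0 : R2) ^ 2) * hC1
  have hsq0 : C (a 2 + a 1 ^ 2)⁻¹ * (Q2 a 2 - Q2 a 1 ^ 2) ∈ Bsub a :=
    mul_mem (hC _) (sub_mem (Q2_two_mem_Bsub a) (pow_mem h1 2))
  have hsq1 : C (a 2 + a 1 ^ 2)⁻¹ * (C (2 * a 1) * Q2 a 1) ∈ Bsub a :=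
    mul_mem (hC _) (mul_mem (hC _) h1)
  induction r using MvPolynomial.induction_on with
  | C t => exact ⟨C t, hC t, 0, zero_mem _, by ring⟩
  | add p q hp hq =>
    obtain ⟨b, hb, c, hc, rfl⟩ := hp
    obtain ⟨b', hb', c', hc', rfl⟩ := hq
    exact ⟨b + b', add_mem hb hb', c + c', add_mem hc hc', by ring⟩
  | mul_X p i hp =>
    obtain ⟨b, hb, c, hc, rfl⟩ := hp
    have h0 : ∃ b' ∈ Bsub a, ∃ c' ∈ Bsub a, (b + c * X 0) * X 0 = b' + c' * X 0 :=
      ⟨_, mul_mem hc hsq0, _, add_mem hb (mul_mem hc hsq1), by linear_combination c * hsq⟩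
    fin_cases i
    · exact h0
    · obtain ⟨b', hb', c', hc', h⟩ := h0
      refine ⟨b * Q2 a 1 - C (a 1) * b', sub_mem (mul_mem hb h1) (mul_mem (hC _) hb'),
        c * Q2 a 1 - C (a 1) * c', sub_mem (mul_mem hc h1) (mul_mem (hC _) hc'), ?_⟩
      have : (X 1 : R2) = Q2 a 1 - C (a 1) * X 0 := by simp [Q2]
      change (b + c * X 0) * X 1 = _
      rw [this]
      linear_combination (-C (a 1)) * h

/-- The involution of `ℂ[y,z]` fixing `Q_1` and `Q_2`. -/
def reflection (a : ℕ → ℂ) : R2 →ₐ[ℂ] R2 :=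
  aeval ![C (2 * a 1 / (a 2 + a 1 ^ 2)) * Q2 a 1 - X 0,
    Q2 a 1 - C (a 1) * (C (2 * a 1 / (a 2 + a 1 ^ 2)) * Q2 a 1 - X 0)]

theorem reflection_Bsub (a : ℕ → ℂ) (h2 : a 2 ≠ -(a 1) ^ 2) {b : R2} (hb : b ∈ Bsub a) :
    reflection a b = b := by
  have hs : a 2 + a 1 ^ 2 ≠ 0 := fun h => h2 (eq_neg_of_add_eq_zero_left h)
  have hC : (C (2 * a 1 / (a 2 + a 1 ^ 2)) : R2) * (C (a 2) + C (a 1) ^ 2) = 2 * C (a 1) := by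
    rw [← C_pow, ← C_add, ← C_mul, div_mul_cancel₀ _ hs, C_mul]
    rfl
  refine (AlgHom.eqOn_adjoin_iff (φ := reflection a) (ψ := AlgHom.id ℂ R2)).2 ?_ hb
  rintro f (rfl | rfl)
  · simp [reflection, Q2, algebraMap_eq]
  · simp only [reflection, Q2, algebraMap_eq, map_add, map_mul, map_pow, aeval_X, aeval_C,
      AlgHom.coe_id, id_eq, Matrix.cons_val_zero, Matrix.cons_val_one]
    generalize C (2 * a 1 / (a 2 + a 1 ^ 2)) = t at hC
    linear_combination (t * (C (a 1) * X 0 + X 1) ^ 2 - 2 * X 0 * (C (a 1) * X 0 + X 1)) * hC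

theorem eq_zero_of_mul_X_mem_Bsub (a : ℕ → ℂ) (h2 : a 2 ≠ -(a 1) ^ 2)
    {c : R2} (hc : c ∈ Bsub a) (h : c * X 0 ∈ Bsub a) : c = 0 := by
  have h' := reflection_Bsub a h2 h
  rw [map_mul, reflection_Bsub a h2 hc] at h'
  by_contra h0
  have h'' := congrArg (eval ![1, -a 1]) (mul_left_cancel₀ h0 h')
  simp only [reflection, Q2, aeval_X, Matrix.cons_val_zero, map_sub, map_mul, map_add, map_pow,
    eval_C, eval_X, Matrix.cons_val_one] at h''
  norm_num at h''

theorem Q2_three_notMem_Bsub (a : ℕ → ℂ) (h1 : a 1 ≠ 0) (h2 : a 2 ≠ -(a 1) ^ 2)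
    (h3 : (a 2, a 3) ≠ ((a 1) ^ 2, (a 1) ^ 3)) : Q2 a 3 ∉ Bsub a := by
  intro h
  have hs : a 2 + a 1 ^ 2 ≠ 0 := fun h => h2 (eq_neg_of_add_eq_zero_left h)
  have h' := reflection_Bsub a h2 h
  have e1 := congrArg (eval ![1, -a 1]) h'
  have e2 := congrArg (eval ![0, 1]) h'
  simp only [reflection, Q2, aeval_X, aeval_C, algebraMap_eq, Matrix.cons_val_zero, map_sub,
    map_mul, map_add, map_pow, eval_C, eval_X, Matrix.cons_val_one] at e1 e2
  have h31 : a 3 = a 1 ^ 3 := by linear_combination (-1 / 2) * e1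
  rw [h31] at e2
  have hx : a 1 * (2 * a 1 / (a 2 + a 1 ^ 2)) ≠ 0 := by
    simp [h1, hs]
  have hx1 : a 1 * (2 * a 1 / (a 2 + a 1 ^ 2)) = 1 := by
    refine mul_left_cancel₀ hx ?_
    linear_combination (1 / 3) * e2
  refine h3 (Prod.ext ?_ h31)
  field_simp at hx1
  linear_combination -hx1

/-- The `ℂ`-subspace `B + B g` of `ℂ[y,z]`, where `B = ℂ[Q_1,Q_2]`. -/
def BsubAdd (a : ℕ → ℂ) (g : R2) : Submodule ℂ R2 :=
  Subalgebra.toSubmodule (Bsub a) ⊔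
    (Subalgebra.toSubmodule (Bsub a)).map (LinearMap.mulRight ℂ g)

theorem mem_BsubAdd {a : ℕ → ℂ} {g r : R2} :
    r ∈ BsubAdd a g ↔ ∃ b ∈ Bsub a, ∃ c ∈ Bsub a, r = b + c * g := by
  simp [BsubAdd, Submodule.mem_sup, eq_comm]

instance finiteDimensional_comp2 (M : Submodule ℂ R2) (n : ℕ) : FiniteDimensional ℂ (comp2 M n) :=
  Submodule.finiteDimensional_of_le (S₂ := homogeneousSubmodule (Fin 2) ℂ n) inf_le_right

theorem mem_comp2 {M : Submodule ℂ R2} {n : ℕ} {r : R2} :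
    r ∈ comp2 M n ↔ r ∈ M ∧ r.IsHomogeneous n := Iff.rfl

theorem comp2_BsubAdd_of_lt {a : ℕ → ℂ} {g : R2} {k n : ℕ} (hg : g.IsHomogeneous k) (hn : n < k) :
    comp2 (BsubAdd a g) n = comp2 (Subalgebra.toSubmodule (Bsub a)) n := by
  refine le_antisymm (fun r hr => ?_) (inf_le_inf_right _ le_sup_left)
  obtain ⟨hr, hrn⟩ := mem_comp2.1 hr
  refine mem_comp2.2 ⟨?_, hrn⟩
  obtain ⟨b, hb, c, hc, rfl⟩ := mem_BsubAdd.1 hr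
  rw [← homogeneousComponent_eq_self hrn, map_add, homogeneousComponent_mul_of_isHomogeneous hg,
    if_neg hn.not_ge, add_zero]
  exact homogeneousComponent_mem_Bsub hb n

theorem exists_eq_add_mul_of_mem_comp2 {a : ℕ → ℂ} {g r : R2} {k n : ℕ} (hg : g.IsHomogeneous k)
    (hr : r ∈ comp2 (BsubAdd a g) (n + k)) :
    ∃ b ∈ comp2 (Subalgebra.toSubmodule (Bsub a)) (n + k),
      ∃ c ∈ comp2 (Subalgebra.toSubmodule (Bsub a)) n, r = b + c * g := by
  obtain ⟨hr, hrn⟩ := mem_comp2.1 hr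
  obtain ⟨b, hb, c, hc, rfl⟩ := mem_BsubAdd.1 hr
  refine ⟨homogeneousComponent (n + k) b, ⟨homogeneousComponent_mem_Bsub hb _,
    homogeneousComponent_isHomogeneous _ _⟩, homogeneousComponent n c,
    ⟨homogeneousComponent_mem_Bsub hc _, homogeneousComponent_isHomogeneous _ _⟩, ?_⟩
  conv_lhs => rw [← homogeneousComponent_eq_self hrn, map_add,
    homogeneousComponent_mul_of_isHomogeneous hg, if_pos (by omega), Nat.add_sub_cancel]

theorem finrank_comp2_BsubAdd {a : ℕ → ℂ} {g : R2} {k : ℕ} (hg : g.IsHomogeneous k)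
    (hgB : ∀ c ∈ Bsub a, c * g ∈ Bsub a → c = 0) (n : ℕ) :
    Module.finrank ℂ (comp2 (BsubAdd a g) (n + k)) =
      Module.finrank ℂ (comp2 (Subalgebra.toSubmodule (Bsub a)) (n + k)) +
        Module.finrank ℂ (comp2 (Subalgebra.toSubmodule (Bsub a)) n) := by
  have hg0 : g ≠ 0 := by
    rintro rfl
    exact one_ne_zero (hgB 1 (one_mem _) (by simp))
  have hinj : Function.Injective (LinearMap.mulRight ℂ g) := mul_left_injective₀ hg0
  have hsup : comp2 (BsubAdd a g) (n + k) = comp2 (Subalgebra.toSubmodule (Bsub a)) (n + k) ⊔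
      (comp2 (Subalgebra.toSubmodule (Bsub a)) n).map (LinearMap.mulRight ℂ g) := by
    refine le_antisymm (fun r hr => ?_) (sup_le (inf_le_inf_right _ le_sup_left) ?_)
    · obtain ⟨b, hb, c, hc, rfl⟩ := exists_eq_add_mul_of_mem_comp2 hg hr
      exact Submodule.add_mem_sup hb (Submodule.mem_map_of_mem hc)
    · rintro _ ⟨c, hc, rfl⟩
      exact ⟨mem_BsubAdd.2 ⟨0, zero_mem _, c, hc.1, by simp⟩, hc.2.mul hg⟩
  have hinf : comp2 (Subalgebra.toSubmodule (Bsub a)) (n + k) ⊓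
      (comp2 (Subalgebra.toSubmodule (Bsub a)) n).map (LinearMap.mulRight ℂ g) = ⊥ := by
    rw [eq_bot_iff]
    rintro _ ⟨hb, c, hc, rfl⟩
    rw [hgB c hc.1 hb.1, map_zero]
    exact zero_mem _
  have h := Submodule.finrank_sup_add_finrank_inf_eq
    (comp2 (Subalgebra.toSubmodule (Bsub a)) (n + k))
    ((comp2 (Subalgebra.toSubmodule (Bsub a)) n).map (LinearMap.mulRight ℂ g))
  rwa [hinf, finrank_bot, add_zero, ← hsup,
    ← (Submodule.equivMapOfInjective _ hinj _).finrank_eq] at h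

theorem BsubAdd_X {a : ℕ → ℂ} (h2 : a 2 ≠ -(a 1) ^ 2) : BsubAdd a (X 0) = ⊤ :=
  eq_top_iff.2 fun r _ => mem_BsubAdd.2 (exists_eq_add_mul_X a h2 r)

theorem finrank_comp2_top (n : ℕ) : Module.finrank ℂ (comp2 ⊤ n) = n + 1 := by
  rw [comp2, top_inf_eq, finrank_homogeneousSubmodule_fin_two]

theorem finrank_comp2_BsubAdd_of_isHomogeneous_two {a : ℕ → ℂ} (h2 : a 2 ≠ -(a 1) ^ 2) {p : R2}
    (hp : p ∈ Bsub a) (hp0 : p ≠ 0) (hp2 : p.IsHomogeneous 2) {i : ℕ} (hi : 1 ≤ i) :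
    Module.finrank ℂ (comp2 (BsubAdd a (p * X 0)) i) = i := by
  have hrec : ∀ n, n + 2 = Module.finrank ℂ (comp2 (Subalgebra.toSubmodule (Bsub a)) (n + 1)) +
      Module.finrank ℂ (comp2 (Subalgebra.toSubmodule (Bsub a)) n) := fun n => by
    rw [← finrank_comp2_BsubAdd (isHomogeneous_X ℂ 0) (fun c => eq_zero_of_mul_X_mem_Bsub a h2),
      BsubAdd_X h2, finrank_comp2_top]
  have hzero : Module.finrank ℂ (comp2 (Subalgebra.toSubmodule (Bsub a)) 0) = 1 := by
    rw [← comp2_BsubAdd_of_lt (isHomogeneous_X ℂ 0) one_pos, BsubAdd_X h2, finrank_comp2_top]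
  have hpX : (p * X 0).IsHomogeneous 3 := hp2.mul (isHomogeneous_X ℂ 0)
  have hpB : ∀ c ∈ Bsub a, c * (p * X 0) ∈ Bsub a → c = 0 := fun c hc h =>
    (mul_eq_zero.1 (eq_zero_of_mul_X_mem_Bsub a h2 (mul_mem hc hp)
      (by rwa [mul_assoc]))).resolve_right hp0
  obtain hi3 | hi3 := lt_or_ge i 3
  · rw [comp2_BsubAdd_of_lt hpX hi3]
    have hrec0 : 2 = _ + _ := hrec 0
    have hrec1 : 3 = Module.finrank ℂ (comp2 (Subalgebra.toSubmodule (Bsub a)) 2) + _ := hrec 1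
    rw [hzero, zero_add] at hrec0
    interval_cases i <;> omega
  · obtain ⟨n, rfl⟩ := Nat.exists_eq_add_of_le' hi3
    rw [finrank_comp2_BsubAdd hpX hpB]
    have hrec0 := hrec n
    have hrec1 : n + 3 = Module.finrank ℂ (comp2 (Subalgebra.toSubmodule (Bsub a)) (n + 2)) + _ :=
      hrec (n + 1)
    have hrec2 : n + 4 = Module.finrank ℂ (comp2 (Subalgebra.toSubmodule (Bsub a)) (n + 3)) + _ :=
      hrec (n + 2)
    omega

theorem exists_Q2_three_eq {a : ℕ → ℂ} (h1 : a 1 ≠ 0) (h2 : a 2 ≠ -(a 1) ^ 2)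
    (h3 : (a 2, a 3) ≠ ((a 1) ^ 2, (a 1) ^ 3)) :
    ∃ p ∈ Bsub a, p ≠ 0 ∧ p.IsHomogeneous 2 ∧ p * X 0 ∈ Lam a := by
  obtain ⟨b, hb, p, hp, h⟩ := exists_eq_add_mul_of_mem_comp2 (a := a) (n := 2)
    (isHomogeneous_X ℂ (0 : Fin 2)) (r := Q2 a 3)
    ⟨by rw [BsubAdd_X h2]; trivial, isHomogeneous_Q2 a 3⟩
  refine ⟨p, hp.1, ?_, hp.2, ?_⟩
  · rintro rfl
    rw [zero_mul, add_zero] at h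
    exact Q2_three_notMem_Bsub a h1 h2 h3 (h ▸ hb.1)
  · rw [← sub_eq_iff_eq_add'.2 h]
    exact sub_mem (Q2_mem_Lam a (by omega)) (Bsub_le_Lam a hb.1)

theorem BsubAdd_le_Lam {a : ℕ → ℂ} {g : R2} (hg : g ∈ Lam a) :
    BsubAdd a g ≤ Subalgebra.toSubmodule (Lam a) := fun r hr => by
  obtain ⟨b, hb, c, hc, rfl⟩ := mem_BsubAdd.1 hr
  exact (Lam a).add_mem (Bsub_le_Lam a hb) ((Lam a).mul_mem (Bsub_le_Lam a hc) hg)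

theorem eq_add_mul_X_injective {a : ℕ → ℂ} (h2 : a 2 ≠ -(a 1) ^ 2) {b c b' c' : R2}
    (hb : b ∈ Bsub a) (hc : c ∈ Bsub a) (hb' : b' ∈ Bsub a) (hc' : c' ∈ Bsub a)
    (h : b + c * X 0 = b' + c' * X 0) : b = b' ∧ c = c' := by
  have hcc : c - c' = 0 := eq_zero_of_mul_X_mem_Bsub a h2 (sub_mem hc hc') <| by
    rw [show (c - c') * X 0 = b' - b by linear_combination h]
    exact sub_mem hb' hb
  obtain rfl := sub_eq_zero.1 hcc
  exact ⟨add_right_cancel h, rfl⟩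

/-- A free submodule of a module generated by two elements is generated by two elements. -/
theorem exists_two_generators_of_free {A M : Type*} [CommRing A] [Nontrivial A] [AddCommGroup M]
    [Module A M] (N : Submodule A M) [Module.Free A N] (x : Fin 2 → M)
    (hx : Submodule.span A (Set.range x) = ⊤) :
    ∃ e : Fin 2 → N, ∀ r : N, ∃ p q : A, r = p • e 0 + q • e 1 := by
  let v := Module.Free.chooseBasis A N
  have hli : LinearIndependent A (N.subtype ∘ v) :=
    v.linearIndependent.map' N.subtype (Submodule.ker_subtype _)
  have hspan : Set.range (N.subtype ∘ v) ≤ Submodule.span A (Set.range x) := by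
    rw [hx]
    exact Set.subset_univ _
  have hfin := hli.finite_of_le_span_finite _ _ hspan
  have := Fintype.ofFinite (Module.Free.ChooseBasisIndex A N)
  have : Fintype (Set.range x) := Fintype.ofFinite _
  have hcard : Fintype.card (Module.Free.ChooseBasisIndex A N) ≤ Fintype.card (Fin 2) :=
    (linearIndependent_le_span_aux' _ hli _ hspan).trans
      (Fintype.card_le_of_surjective _ (Set.rangeFactorization_surjective (f := x)))
  obtain ⟨f⟩ := Function.Embedding.nonempty_of_card_le hcard
  let e : Fin 2 → N := Function.extend f v 0
  refine ⟨e, fun r => ?_⟩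
  let w : Fin 2 → A := Function.extend f (v.repr r) 0
  refine ⟨w 0, w 1, ?_⟩
  rw [← Fin.sum_univ_two (f := fun j => w j • e j)]
  conv_lhs => rw [← v.sum_repr r]
  have hwe : ∀ i, v.repr r i • v i = w (f i) • e (f i) := fun i => by
    simp only [w, e, f.injective.extend_apply]
  simp only [hwe]
  exact Finset.sum_of_injOn f f.injective.injOn (by simp) (fun j _ hj => by
    have : w j = 0 := Function.extend_apply' _ _ _ (by simpa using hj)
    rw [this, zero_smul]) (fun _ _ => rfl)

/-- If `Λ_a` is free over `ℂ[Q_1,Q_2]`, then it is generated by two elements. -/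
theorem exists_generators_of_free {a : ℕ → ℂ} (h2 : a 2 ≠ -(a 1) ^ 2)
    [Module.Free ↥(Bsub a) ↥(LamMod a)] :
    ∃ e₁ ∈ Lam a, ∃ e₂ ∈ Lam a, ∀ r ∈ Lam a,
      ∃ p ∈ Bsub a, ∃ q ∈ Bsub a, r = p * e₁ + q * e₂ := by
  have hspan : Submodule.span ↥(Bsub a) (Set.range ![(1 : R2), X 0]) = ⊤ := by
    refine eq_top_iff.2 fun r _ => ?_
    obtain ⟨b, hb, c, hc, rfl⟩ := exists_eq_add_mul_X a h2 r
    have h0 := Submodule.smul_mem (Submodule.span ↥(Bsub a) (Set.range ![(1 : R2), X 0]))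
      (⟨b, hb⟩ : Bsub a) (Submodule.subset_span ⟨0, rfl⟩)
    have h1 := Submodule.smul_mem (Submodule.span ↥(Bsub a) (Set.range ![(1 : R2), X 0]))
      (⟨c, hc⟩ : Bsub a) (Submodule.subset_span ⟨1, rfl⟩)
    simpa [Subalgebra.smul_def] using add_mem h0 h1
  obtain ⟨e, he⟩ := exists_two_generators_of_free (LamMod a) _ hspan
  refine ⟨e 0, mem_LamMod.1 (e 0).2, e 1, mem_LamMod.1 (e 1).2, fun r hr => ?_⟩
  obtain ⟨p, q, h⟩ := he ⟨r, mem_LamMod.2 hr⟩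
  exact ⟨p, p.2, q, q.2, congrArg Subtype.val h⟩

/-- If `Λ_a` is generated by two elements over `B = ℂ[Q_1,Q_2]`, then the ideal of all `c ∈ B` with
`c y ∈ Λ_a` is generated by the determinant of the two generators with respect to the basis
`1, y` of `ℂ[y,z]`. -/
theorem exists_ideal_generator {a : ℕ → ℂ} (h2 : a 2 ≠ -(a 1) ^ 2) {e₁ e₂ : R2}
    (he₁ : e₁ ∈ Lam a) (he₂ : e₂ ∈ Lam a)
    (h : ∀ r ∈ Lam a, ∃ p ∈ Bsub a, ∃ q ∈ Bsub a, r = p * e₁ + q * e₂) :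
    ∃ d ∈ Bsub a, d * X 0 ∈ Lam a ∧
      ∀ c ∈ Bsub a, c * X 0 ∈ Lam a → ∃ t ∈ Bsub a, c = d * t := by
  obtain ⟨b₁, hb₁, c₁, hc₁, rfl⟩ := exists_eq_add_mul_X a h2 e₁
  obtain ⟨b₂, hb₂, c₂, hc₂, rfl⟩ := exists_eq_add_mul_X a h2 e₂
  refine ⟨b₁ * c₂ - b₂ * c₁, sub_mem (mul_mem hb₁ hc₂) (mul_mem hb₂ hc₁), ?_, ?_⟩
  · have := sub_mem (mul_mem (Bsub_le_Lam a hb₁) he₂) (mul_mem (Bsub_le_Lam a hb₂) he₁)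
    convert this using 1
    ring
  · intro c hc hcX
    obtain ⟨p, hp, q, hq, h1⟩ := h 1 (one_mem _)
    obtain ⟨p', hp', q', hq', h'⟩ := h _ hcX
    obtain ⟨h1b, h1c⟩ := eq_add_mul_X_injective h2 (one_mem _) (zero_mem _)
      (add_mem (mul_mem hp hb₁) (mul_mem hq hb₂)) (add_mem (mul_mem hp hc₁) (mul_mem hq hc₂))
      (show 1 + 0 * X 0 = _ by linear_combination h1)
    obtain ⟨-, hcc⟩ := eq_add_mul_X_injective h2 (zero_mem _) hc
      (add_mem (mul_mem hp' hb₁) (mul_mem hq' hb₂)) (add_mem (mul_mem hp' hc₁) (mul_mem hq' hc₂))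
      (show 0 + c * X 0 = _ by linear_combination h')
    refine ⟨p * q' - q * p', sub_mem (mul_mem hp hq') (mul_mem hq hp'), ?_⟩
    rw [hcc]
    linear_combination (p' * c₁ + q' * c₂) * h1b - (p' * b₁ + q' * b₂) * h1c

theorem Lam_le_BsubAdd_of_free {a : ℕ → ℂ} (h2 : a 2 ≠ -(a 1) ^ 2) {p : R2}
    (hp : p ∈ Bsub a) (hp0 : p ≠ 0) (hp2 : p.IsHomogeneous 2) (hpX : p * X 0 ∈ Lam a)
    [Module.Free ↥(Bsub a) ↥(LamMod a)] :
    Subalgebra.toSubmodule (Lam a) ≤ BsubAdd a (p * X 0) := by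
  obtain ⟨e₁, he₁, e₂, he₂, he⟩ := exists_generators_of_free h2
  obtain ⟨d, hd, hdX, hdiv⟩ := exists_ideal_generator h2 he₁ he₂ he
  obtain ⟨t, ht, rfl⟩ := hdiv p hp hpX
  have hd0 : d ≠ 0 := left_ne_zero_of_mul hp0
  have ht0 : t ≠ 0 := right_ne_zero_of_mul hp0
  have hdeg : d.totalDegree + t.totalDegree = 2 := by
    rw [← totalDegree_mul_of_isDomain hd0 ht0, hp2.totalDegree hp0]
  have hcomp : ∀ n ≤ 1, homogeneousComponent n d = 0 := fun n hn => by
    refine eq_zero_of_mul_X_mem_Bsub a h2 (homogeneousComponent_mem_Bsub hd n) ?_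
    have := homogeneousComponent_mem_Bsub_of_mem_Lam hdX (n := n + 1) (by omega)
    rwa [homogeneousComponent_mul_of_isHomogeneous (isHomogeneous_X ℂ 0), if_pos (by omega),
      Nat.add_sub_cancel] at this
  have hd2 : 2 ≤ d.totalDegree := by
    by_contra! hlt
    refine hd0 ?_
    rw [← sum_homogeneousComponent d]
    exact Finset.sum_eq_zero fun i hi => hcomp i (by rw [Finset.mem_range] at hi; omega)
  obtain ⟨k, rfl⟩ : ∃ k, t = C k := ⟨_, totalDegree_eq_zero_iff_eq_C.1 (by omega)⟩
  have hk : k ≠ 0 := by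
    rintro rfl
    exact ht0 C_0
  intro r hr
  obtain ⟨b, hb, c, hc, rfl⟩ := exists_eq_add_mul_X a h2 r
  obtain ⟨s, hs, rfl⟩ := hdiv c hc (by
    have := sub_mem hr (Bsub_le_Lam a hb)
    rwa [add_sub_cancel_left] at this)
  refine mem_BsubAdd.2 ⟨b, hb, C k⁻¹ * s, mul_mem ((Bsub a).algebraMap_mem _) hs, ?_⟩
  have hkk : (C k⁻¹ : R2) * C k = 1 := by rw [← C_mul, inv_mul_cancel₀ hk, C_1]
  linear_combination (-d * s * X 0) * hkk

theorem free_of_Lam_eq_BsubAdd {a : ℕ → ℂ} {g : R2}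
    (hgB : ∀ c ∈ Bsub a, c * g ∈ Bsub a → c = 0)
    (h : Subalgebra.toSubmodule (Lam a) = BsubAdd a g) :
    Module.Free ↥(Bsub a) ↥(LamMod a) := by
  let φ : (Bsub a × Bsub a) →ₗ[Bsub a] R2 :=
    LinearMap.coprod (LinearMap.toSpanSingleton _ _ 1) (LinearMap.toSpanSingleton _ _ g)
  have hφ : ∀ x, φ x = x.1 + x.2 * g := fun x => by simp [φ, Subalgebra.smul_def]
  have hinj : Function.Injective φ := by
    rw [← LinearMap.ker_eq_bot, LinearMap.ker_eq_bot']
    rintro ⟨⟨b, hb⟩, ⟨c, hc⟩⟩ hx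
    rw [hφ] at hx
    obtain rfl := hgB c hc (eq_neg_of_add_eq_zero_right hx ▸ neg_mem hb)
    rw [zero_mul, add_zero] at hx
    exact Prod.ext (Subtype.ext hx) rfl
  have hrange : LinearMap.range φ = LamMod a := by
    ext r
    rw [mem_LamMod, ← Subalgebra.mem_toSubmodule, h, mem_BsubAdd]
    constructor
    · rintro ⟨x, rfl⟩
      exact ⟨x.1, x.1.2, x.2, x.2.2, hφ x⟩
    · rintro ⟨b, hb, c, hc, rfl⟩
      exact ⟨(⟨b, hb⟩, ⟨c, hc⟩), hφ _⟩
  rw [← hrange]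
  exact Module.Free.of_equiv (LinearEquiv.ofInjective φ hinj)

/-- If `a_2 ≠ -a_1^2` and `(a_2,a_3) ≠ (a_1^2,a_1^3)`, then `Λ_a` is Cohen–Macaulay
(equivalently, free as a module over `ℂ[Q_1,Q_2]`) if and only if for every `i ≥ 1` the
degree-`i` homogeneous component of `Λ_a` has dimension exactly `i` (i.e. codimension `1`
in the degree-`i` homogeneous polynomials). -/
theorem lambda_CM_iff_codim_one (a : ℕ → ℂ) (ha : ∀ i : ℕ, 1 ≤ i → a i ≠ 0)
    (h2 : a 2 ≠ -(a 1) ^ 2) (h3 : (a 2, a 3) ≠ ((a 1) ^ 2, (a 1) ^ 3)) :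
    Module.Free ↥(Bsub a) ↥(LamMod a) ↔
      ∀ i : ℕ, 1 ≤ i →
        Module.finrank ℂ (comp2 (Subalgebra.toSubmodule (Lam a)) i) = i := by
  obtain ⟨p, hp, hp0, hp2, hpX⟩ := exists_Q2_three_eq (ha 1 le_rfl) h2 h3
  have hle := BsubAdd_le_Lam hpX
  refine ⟨fun _ i hi => ?_, fun h => ?_⟩
  · rw [le_antisymm (Lam_le_BsubAdd_of_free h2 hp hp0 hp2 hpX) hle]
    exact finrank_comp2_BsubAdd_of_isHomogeneous_two h2 hp hp0 hp2 hi
  · refine free_of_Lam_eq_BsubAdd (g := p * X 0) (fun c hc hcX => ?_)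
      (le_antisymm (fun r hr => ?_) hle)
    · exact (mul_eq_zero.1 (eq_zero_of_mul_X_mem_Bsub a h2 (mul_mem hc hp)
        (by rwa [mul_assoc]))).resolve_right hp0
    · rw [← sum_homogeneousComponent r]
      refine sum_mem fun i _ => ?_
      obtain rfl | hi := Nat.eq_zero_or_pos i
      · exact (le_sup_left : _ ≤ BsubAdd a (p * X 0))
          (homogeneousComponent_mem_Bsub_of_mem_Lam hr (by omega))
      · have heq : comp2 (BsubAdd a (p * X 0)) i = comp2 (Subalgebra.toSubmodule (Lam a)) i :=
          Submodule.eq_of_le_of_finrank_eq (inf_le_inf_right _ hle) (by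
            rw [h i hi, finrank_comp2_BsubAdd_of_isHomogeneous_two h2 hp hp0 hp2 hi])
        have hmem : homogeneousComponent i r ∈ comp2 (Subalgebra.toSubmodule (Lam a)) i :=
          ⟨homogeneousComponent_mem_Lam hr i, homogeneousComponent_isHomogeneous i r⟩
        exact (heq ▸ hmem).1
end
end

section
/- Let r, s ≥ 1 be integers, let c ∈ C be nonzero, and let q, t ∈ C be such that neither q nor t is a root of unity; set a_i := c^i (q^i − 1)/(1 − t^i). Then the algebra Λ_{r,s,a} is finitely generated as a C-algebra if and only if q^m ≠ t^n for all integers m, n with 1 ≤ m ≤ r and 1 ≤ n ≤ s. -/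
open MvPolynomial

set_option synthInstance.maxHeartbeats 1000000
set_option maxHeartbeats 1000000

noncomputable section

/-- The polynomial ring `ℂ[y_1,...,y_r,z_1,...,z_s]`, with `y_j = X (inl j)`,
`z_l = X (inr l)`. -/
abbrev Rrs (r s : ℕ) := MvPolynomial (Fin r ⊕ Fin s) ℂ

/-- The generalized power sum `Q_i = a_i (y_1^i + ... + y_r^i) + z_1^i + ... + z_s^i`. -/
def Qrs (r s : ℕ) (a : ℕ → ℂ) (i : ℕ) : Rrs r s :=
  C (a i) * ∑ j : Fin r, X (Sum.inl j) ^ i + ∑ l : Fin s, X (Sum.inr l) ^ i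

/-- The algebra `Λ_{r,s,a}` generated by the `Q_i`, `i ≥ 1`. -/
def LamRS (r s : ℕ) (a : ℕ → ℂ) : Subalgebra ℂ (Rrs r s) :=
  Algebra.adjoin ℂ {f : Rrs r s | ∃ i : ℕ, 1 ≤ i ∧ f = Qrs r s a i}

/-- Complex multisets with the same power sums, including the zeroth one, are equal. -/
theorem multiset_eq_of_power_sums_eq (A B : Multiset ℂ)
    (h : ∀ i : ℕ, (A.map (· ^ i)).sum = (B.map (· ^ i)).sum) : A = B := by
  have hlin := (linearIndependent_monoidHom (Multiplicative ℕ) ℂ).comp (powersHom ℂ)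
    (powersHom ℂ).injective
  rw [linearIndependent_iff'] at hlin
  have hsum : ∀ (M : Multiset ℂ) (T : Finset ℂ), M.toFinset ⊆ T → ∀ i : ℕ,
      (M.map (· ^ i)).sum = ∑ v ∈ T, (M.count v : ℂ) * v ^ i := by
    intro M T hT i
    rw [Finset.sum_multiset_map_count, ← Finset.sum_subset hT]
    · simp [nsmul_eq_mul]
    · intro v _ hv
      simp [Multiset.count_eq_zero.2 (fun h' => hv (Multiset.mem_toFinset.2 h'))]
  have key := hlin (A.toFinset ∪ B.toFinset) (fun v => (A.count v : ℂ) - B.count v) (by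
    ext i
    have := h i.toAdd
    rw [hsum A _ Finset.subset_union_left, hsum B _ Finset.subset_union_right,
      ← sub_eq_zero, ← Finset.sum_sub_distrib] at this
    simpa [sub_mul, powersHom_apply] using this)
  ext v
  by_cases hv : v ∈ A.toFinset ∪ B.toFinset
  · exact_mod_cast sub_eq_zero.1 (key v hv)
  · simp only [Finset.mem_union, Multiset.mem_toFinset, not_or] at hv
    rw [Multiset.count_eq_zero.2 hv.1, Multiset.count_eq_zero.2 hv.2]

/-- Multiplication by a nonzero scalar commutes with discarding zeros. -/
theorem filter_ne_zero_map_mul {q : ℂ} (hq : q ≠ 0) (U : Multiset ℂ) :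
    (U.map (q * ·)).filter (· ≠ 0) = (U.filter (· ≠ 0)).map (q * ·) := by
  rw [Multiset.filter_map]
  congr 1
  exact Multiset.filter_congr (by simp [hq])

theorem pow_card_eq_of_map_mul_add_eq {q t : ℂ} {U Z : Multiset ℂ} (hU : (0 : ℂ) ∉ U)
    (hZ : (0 : ℂ) ∉ Z) (h : U.map (q * ·) + Z = U + Z.map (t * ·)) :
    q ^ U.card = t ^ Z.card := by
  have h1 := congrArg Multiset.prod h
  have hprod : ∀ (x : ℂ) (M : Multiset ℂ), (M.map (x * ·)).prod = x ^ M.card * M.prod := by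
    intro x M
    induction M using Multiset.induction_on with
    | empty => simp
    | cons v M ih =>
      simp only [Multiset.map_cons, Multiset.prod_cons, Multiset.card_cons, ih]
      ring
  rw [Multiset.prod_add, Multiset.prod_add, hprod, hprod] at h1
  have hU' : U.prod ≠ 0 := Multiset.prod_ne_zero hU
  have hZ' : Z.prod ≠ 0 := Multiset.prod_ne_zero hZ
  apply mul_right_cancel₀ (mul_ne_zero hU' hZ')
  linear_combination h1

/-- The multiset form of the statement that the `Q_i` have no common zero but the origin. -/
theorem filter_ne_zero_eq_zero_of_map_mul_add_eq {q t : ℂ}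
    (hq : ∀ n : ℕ, 1 ≤ n → q ^ n ≠ 1) (ht : ∀ n : ℕ, 1 ≤ n → t ^ n ≠ 1) (h0 : q ≠ t)
    {U Z : Multiset ℂ}
    (hqt : ∀ m n : ℕ, 1 ≤ m → m ≤ U.card → 1 ≤ n → n ≤ Z.card → q ^ m ≠ t ^ n)
    (h : U.map (q * ·) + Z = U + Z.map (t * ·)) :
    U.filter (· ≠ 0) = 0 ∧ Z.filter (· ≠ 0) = 0 := by
  have hf := congrArg (Multiset.filter (· ≠ 0)) h
  rw [Multiset.filter_add, Multiset.filter_add] at hf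
  have hU : (0 : ℂ) ∉ U.filter (· ≠ 0) := by simp
  have hZ : (0 : ℂ) ∉ Z.filter (· ≠ 0) := by simp
  have hUc : (U.filter (· ≠ 0)).card ≤ U.card := Multiset.card_le_card (Multiset.filter_le _ _)
  have hZc : (Z.filter (· ≠ 0)).card ≤ Z.card := Multiset.card_le_card (Multiset.filter_le _ _)
  have hzero : ∀ M : Multiset ℂ, (M.map ((0 : ℂ) * ·)).filter (· ≠ 0) = 0 := by
    intro M
    rw [Multiset.filter_eq_nil]
    intro v hv
    obtain ⟨w, _, rfl⟩ := Multiset.mem_map.1 hv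
    simp
  have main : (U.filter (· ≠ 0)).map (q * ·) + Z.filter (· ≠ 0) =
      U.filter (· ≠ 0) + (Z.filter (· ≠ 0)).map (t * ·) := by
    by_cases hq0 : q = 0
    · have ht0 : t ≠ 0 := fun ht0 => h0 (hq0.trans ht0.symm)
      rw [hq0, hzero, filter_ne_zero_map_mul ht0] at hf
      have hc := congrArg Multiset.card hf
      simp only [Multiset.card_add, Multiset.card_map, Multiset.card_zero] at hc
      have hU0 : U.filter (· ≠ 0) = 0 := Multiset.card_eq_zero.1 (by omega)
      rw [hU0] at hf ⊢
      exact hf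
    · by_cases ht0 : t = 0
      · rw [ht0, hzero, filter_ne_zero_map_mul hq0] at hf
        have hc := congrArg Multiset.card hf
        simp only [Multiset.card_add, Multiset.card_map, Multiset.card_zero] at hc
        have hZ0 : Z.filter (· ≠ 0) = 0 := Multiset.card_eq_zero.1 (by omega)
        rw [hZ0] at hf ⊢
        exact hf
      · rwa [filter_ne_zero_map_mul hq0, filter_ne_zero_map_mul ht0] at hf
  have hcard := pow_card_eq_of_map_mul_add_eq hU hZ main
  rw [← Multiset.card_eq_zero, ← Multiset.card_eq_zero]
  rcases Nat.eq_zero_or_pos (U.filter (· ≠ 0)).card with hU0 | hU0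
  · refine ⟨hU0, by_contra fun hZ0 => ht _ (Nat.pos_of_ne_zero hZ0) ?_⟩
    rw [← hcard, hU0, pow_zero]
  · rcases Nat.eq_zero_or_pos (Z.filter (· ≠ 0)).card with hZ0 | hZ0
    · exact absurd (by rw [hcard, hZ0, pow_zero]) (hq _ hU0)
    · exact absurd hcard (hqt _ _ hU0 hUc hZ0 hZc)

/-- A subalgebra of a polynomial ring over an algebraically closed field is finitely generated
as soon as it contains homogeneous elements of positive degree whose only common zero is the
origin. -/
theorem subalgebra_fg_of_homogeneous {σ ι K : Type*} [Finite σ] [Field K] [IsAlgClosed K]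
    (S : Subalgebra K (MvPolynomial σ K)) (f : ι → MvPolynomial σ K) (d : ι → ℕ)
    (hd : ∀ i, 1 ≤ d i) (hf : ∀ i, (f i).IsHomogeneous (d i)) (hfS : ∀ i, f i ∈ S)
    (hzero : ∀ x : σ → K, (∀ i, aeval x (f i) = 0) → x = 0) : S.FG := by
  have hrad : ∀ j : σ, ∃ k : ℕ, (X j : MvPolynomial σ K) ^ k ∈ Ideal.span (Set.range f) := by
    intro j
    have : (X j : MvPolynomial σ K) ∈ (Ideal.span (Set.range f)).radical := by
      rw [← vanishingIdeal_zeroLocus_eq_radical (K := K), mem_vanishingIdeal_iff]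
      intro x hx
      rw [zeroLocus_span] at hx
      simp [hzero x fun i => hx _ ⟨i, rfl⟩]
    exact this
  choose k hk using hrad
  let B : Set (MvPolynomial σ K) :=
    Set.range fun e : ((j : σ) → Fin (k j)) =>
      monomial (Finsupp.equivFunOnFinite.symm fun j => (e j : ℕ)) (1 : K)
  let M : Submodule S (MvPolynomial σ K) := Submodule.span S B
  have hK : ∀ (a : K) (g : MvPolynomial σ K), g ∈ M → C a * g ∈ M := fun a g hg => by
    rw [← MvPolynomial.smul_eq_C_mul, ← algebraMap_smul S a g]
    exact M.smul_mem _ hg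
  have hcomp : ∀ (n : ℕ), (∀ e : σ →₀ ℕ, e.degree = n → monomial e (1 : K) ∈ M) →
      ∀ g : MvPolynomial σ K, homogeneousComponent n g ∈ M := by
    intro n hn g
    rw [homogeneousComponent_apply]
    refine Submodule.sum_mem _ fun e he => ?_
    have := hK (coeff e g) _ (hn e (Finset.mem_filter.1 he).2)
    rwa [C_mul_monomial, mul_one] at this
  have hmon : ∀ (n : ℕ) (e : σ →₀ ℕ), e.degree = n → monomial e (1 : K) ∈ M := by
    intro n
    induction n using Nat.strong_induction_on with
    | _ n ih =>
      intro e he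
      by_cases hlt : ∀ j, e j < k j
      · refine Submodule.subset_span ⟨fun j => ⟨e j, hlt j⟩, ?_⟩
        simp
      · push Not at hlt
        obtain ⟨j, hj⟩ := hlt
        have hmem : monomial e (1 : K) ∈ Ideal.span (Set.range f) := by
          have : monomial e (1 : K) = monomial (e - Finsupp.single j (k j)) 1 * X j ^ k j := by
            rw [X_pow_eq_monomial, monomial_mul, mul_one,
              tsub_add_cancel_of_le (Finsupp.single_le_iff.2 hj)]
          rw [this]
          exact Ideal.mul_mem_left _ _ (hk j)
        obtain ⟨g, hg⟩ := Finsupp.mem_ideal_span_range_iff_exists_finsupp.1 hmem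
        have hhom : (monomial e (1 : K)).IsHomogeneous n := isHomogeneous_monomial _ he
        rw [← homogeneousComponent_eq_self hhom, ← hg, Finsupp.sum, map_sum]
        refine Submodule.sum_mem _ fun i _ => ?_
        let _ : GradedAlgebra (homogeneousSubmodule σ K) := gradedAlgebra
        have hfi : f i ∈ homogeneousSubmodule σ K (d i) := hf i
        rw [← decomposition.decompose'_apply]
        change ((DirectSum.decompose (homogeneousSubmodule σ K) (g i * f i) n :
          homogeneousSubmodule σ K n) : MvPolynomial σ K) ∈ M
        by_cases hle : d i ≤ n
        · rw [DirectSum.coe_decompose_mul_of_right_mem_of_le _ hfi hle, mul_comm]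
          have hlow : homogeneousComponent (n - d i) (g i) ∈ M :=
            hcomp _ (ih _ (by have := hd i; omega)) _
          rw [← decomposition.decompose'_apply] at hlow
          exact M.smul_mem (⟨f i, hfS i⟩ : S) hlow
        · rw [DirectSum.coe_decompose_mul_of_right_mem_of_not_le _ hfi hle]
          exact M.zero_mem
  have hMtop : M = ⊤ := by
    refine eq_top_iff.2 fun g _ => ?_
    rw [← sum_homogeneousComponent g]
    exact Submodule.sum_mem _ fun n _ => hcomp n (hmon n) g
  rw [← S.fg_top]
  refine fg_of_fg_of_fg K S (MvPolynomial σ K) Algebra.FiniteType.out ?_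
    Subtype.val_injective
  rw [← hMtop]
  exact Submodule.fg_span (Set.finite_range _)

/-- If `p` is a zero of every `Q_i` whose coordinate `z_l` does not vanish, then `Λ_{r,s,a}` is
not finitely generated. -/
theorem LamRS_not_fg {r s : ℕ} {a : ℕ → ℂ} (p : Fin r ⊕ Fin s → ℂ)
    (hp : ∀ i, 1 ≤ i → aeval p (Qrs r s a i) = 0) (l : Fin s) (hl : p (Sum.inr l) ≠ 0) :
    ¬ (LamRS r s a).FG := by
  rintro ⟨G, hG⟩
  let φ : Rrs r s →ₐ[ℂ] Polynomial ℂ := aeval fun e => Polynomial.C (p e) * Polynomial.X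
  have hφ : ∀ i, 1 ≤ i → φ (Qrs r s a i) = 0 := by
    intro i hi
    have : φ (Qrs r s a i) = Polynomial.C (aeval p (Qrs r s a i)) * Polynomial.X ^ i := by
      simp [φ, Qrs, mul_pow, ← Finset.sum_mul, add_mul, mul_assoc, Polynomial.algebraMap_eq]
    rw [this, hp i hi]
    simp
  let δ : Rrs r s → Polynomial ℂ := fun g => φ (pderiv (Sum.inr l) g)
  have hδ : ∀ i, δ (Qrs r s a i) =
      Polynomial.C ((i : ℂ) * p (Sum.inr l) ^ (i - 1)) * Polynomial.X ^ (i - 1) := by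
    intro i
    simp [δ, Qrs, φ, Derivation.leibniz_pow, pderiv_X, Pi.single_apply, mul_pow, mul_assoc]
  let N := G.sup fun g => (δ g).natDegree
  have hN : ∀ g ∈ LamRS r s a, φ g ∈ (⊥ : Subalgebra ℂ (Polynomial ℂ)) := by
    intro g hg
    have : LamRS r s a ≤ (⊥ : Subalgebra ℂ (Polynomial ℂ)).comap φ := by
      refine Algebra.adjoin_le ?_
      rintro _ ⟨i, hi, rfl⟩
      simp [hφ i hi]
    exact this hg
  have hdeg : ∀ g ∈ LamRS r s a, (δ g).natDegree ≤ N := by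
    intro g hg
    rw [← hG] at hg
    induction hg using Algebra.adjoin_induction with
    | mem g hg => exact Finset.le_sup (f := fun g => (δ g).natDegree) hg
    | algebraMap c => simp [δ]
    | add g h _ _ ihg ihh =>
      simp only [δ, map_add] at ihg ihh ⊢
      exact Polynomial.natDegree_add_le_of_degree_le ihg ihh
    | mul g h hg hh ihg ihh =>
      obtain ⟨b, hb⟩ := Algebra.mem_bot.1 (hN g (hG ▸ hg))
      obtain ⟨b', hb'⟩ := Algebra.mem_bot.1 (hN h (hG ▸ hh))
      simp only [δ, Derivation.leibniz, map_add, smul_eq_mul, map_mul, ← hb, ← hb',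
        Polynomial.algebraMap_eq] at ihg ihh ⊢
      exact Polynomial.natDegree_add_le_of_degree_le
        ((Polynomial.natDegree_C_mul_le _ _).trans ihh)
        ((Polynomial.natDegree_C_mul_le _ _).trans ihg)
  have hmem : Qrs r s a (N + 2) ∈ LamRS r s a := Algebra.subset_adjoin ⟨N + 2, by omega, rfl⟩
  have h1 := hdeg _ hmem
  rw [hδ, Polynomial.natDegree_C_mul_X_pow] at h1
  · clear_value N
    omega
  · exact mul_ne_zero (Nat.cast_ne_zero.2 (by omega)) (pow_ne_zero _ hl)

theorem Qrs_isHomogeneous (r s : ℕ) (a : ℕ → ℂ) (i : ℕ) : (Qrs r s a i).IsHomogeneous i := by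
  refine IsHomogeneous.add ?_ (IsHomogeneous.sum _ _ _ fun l _ => isHomogeneous_X_pow _ _)
  exact (IsHomogeneous.sum _ _ _ fun j _ => isHomogeneous_X_pow _ _).C_mul _

theorem aeval_Qrs (r s : ℕ) (a : ℕ → ℂ) (i : ℕ) (x : Fin r ⊕ Fin s → ℂ) :
    aeval x (Qrs r s a i) = a i * ∑ j, x (Sum.inl j) ^ i + ∑ l, x (Sum.inr l) ^ i := by
  simp [Qrs]

/-- For `r, s ≥ 1`, `c ≠ 0` and `q, t` not roots of unity, with
`a_i = c^i (q^i - 1)/(1 - t^i)`, the algebra `Λ_{r,s,a}` is finitely generated as a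
`ℂ`-algebra if and only if `q^m ≠ t^n` for all `1 ≤ m ≤ r`, `1 ≤ n ≤ s`. -/
theorem lambdaRS_fg_iff (r s : ℕ) (hr : 1 ≤ r) (hs : 1 ≤ s) (c q t : ℂ) (hc : c ≠ 0)
    (hq : ∀ n : ℕ, 1 ≤ n → q ^ n ≠ 1) (ht : ∀ n : ℕ, 1 ≤ n → t ^ n ≠ 1) :
    (LamRS r s (fun i => c ^ i * (q ^ i - 1) / (1 - t ^ i))).FG ↔
      ∀ m n : ℕ, 1 ≤ m → m ≤ r → 1 ≤ n → n ≤ s → q ^ m ≠ t ^ n := by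
  constructor
  · intro hfg m n hm hmr hn hns hqt
    have hsum : ∀ (k m : ℕ) (b x : ℂ) (i : ℕ), m ≤ k → 1 ≤ i →
        ∑ j : Fin k, (if (j : ℕ) < m then b * x ^ (j : ℕ) else 0) ^ i * (x ^ i - 1) =
          b ^ i * ((x ^ m) ^ i - 1) := by
      intro k m b x i hmk hi
      rw [Fin.sum_univ_eq_sum_range
          (fun j => (if j < m then b * x ^ j else 0) ^ i * (x ^ i - 1)) k,
        ← Finset.sum_subset (Finset.range_subset_range.2 hmk), pow_right_comm, ← geom_sum_mul (x ^ i) m,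
        ← mul_assoc, Finset.mul_sum, Finset.sum_mul]
      · refine Finset.sum_congr rfl fun j hj => ?_
        rw [if_pos (Finset.mem_range.1 hj)]
        ring
      · intro j _ hj
        rw [if_neg (by simpa using hj), zero_pow (by omega), zero_mul]
    refine LamRS_not_fg (Sum.elim (fun j : Fin r => if (j : ℕ) < m then c⁻¹ * q ^ (j : ℕ) else 0)
      fun l : Fin s => if (l : ℕ) < n then 1 * t ^ (l : ℕ) else 0) ?_ ⟨0, hs⟩ ?_ hfg
    · intro i hi
      have hti : t ^ i - 1 ≠ 0 := sub_ne_zero.2 (ht i hi)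
      have hti' : 1 - t ^ i ≠ 0 := sub_ne_zero.2 (ht i hi).symm
      have h1 := hsum r m c⁻¹ q i hmr hi
      have h2 := hsum s n 1 t i hns hi
      rw [← Finset.sum_mul] at h1 h2
      rw [aeval_Qrs]
      simp only [Sum.elim_inl, Sum.elim_inr]
      have ha : c ^ i * (q ^ i - 1) / (1 - t ^ i) * (t ^ i - 1) = -(c ^ i * (q ^ i - 1)) := by
        field_simp
        ring
      have hcc : c ^ i * c⁻¹ ^ i = 1 := by rw [← mul_pow, mul_inv_cancel₀ hc, one_pow]
      rw [hqt] at h1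
      rw [one_pow, one_mul] at h2
      apply mul_right_cancel₀ hti
      generalize (∑ j : Fin r, (if (j : ℕ) < m then c⁻¹ * q ^ (j : ℕ) else 0) ^ i) = S at *
      linear_combination S * ha - c ^ i * h1 + h2 - ((t ^ n) ^ i - 1) * hcc
    · simp; omega
  · intro hqt
    refine subalgebra_fg_of_homogeneous _ (fun i : ℕ => Qrs r s _ (i + 1)) (fun i => i + 1)
      (fun i => by omega) (fun i => Qrs_isHomogeneous _ _ _ _)
      (fun i => Algebra.subset_adjoin ⟨i + 1, by omega, rfl⟩) fun x hx => ?_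
    let U : Multiset ℂ := Finset.univ.val.map fun j : Fin r => c * x (Sum.inl j)
    let Z : Multiset ℂ := Finset.univ.val.map fun l : Fin s => x (Sum.inr l)
    have hUZ : U.map (q * ·) + Z = U + Z.map (t * ·) := by
      apply multiset_eq_of_power_sums_eq
      intro i
      rcases i with _ | i
      · simp only [pow_zero, Multiset.map_const', Multiset.sum_replicate, Multiset.card_add,
          Multiset.card_map]
      · have hti : 1 - t ^ (i + 1) ≠ 0 := sub_ne_zero.2 (ht (i + 1) (by omega)).symm
        have h1 := hx i
        rw [aeval_Qrs] at h1
        field_simp at h1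
        simp only [U, Z, Multiset.map_add, Multiset.sum_add, Multiset.map_map, Function.comp_def,
          Finset.sum_map_val, mul_pow, ← Finset.mul_sum]
        linear_combination h1
    obtain ⟨hU, hZ⟩ := filter_ne_zero_eq_zero_of_map_mul_add_eq hq ht
      (by simpa using hqt 1 1 le_rfl hr le_rfl hs) (by simpa [U, Z] using hqt) hUZ
    rw [Multiset.filter_eq_nil] at hU hZ
    ext (j | l)
    · simpa [hc] using hU (c * x (Sum.inl j)) (Multiset.mem_map.2 ⟨j, by simp, rfl⟩)
    · simpa using hZ (x (Sum.inr l)) (Multiset.mem_map.2 ⟨l, by simp, rfl⟩)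
end
end
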